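/- There exist universal constants C ≥ c > 0 such that for all 0 ≤ r < ∞, 1 ≤ p < ∞, integer n ≥ 2, and X a random vector in ℝ^n with the standard normal distribution: if r ∈ [0,1] then 𝕄 ∑_{i=1}^{n} i^{-r}·X_[i]^p ≤ C^p·p^{p/2}·n^{1-r}·(ln n)^{1+p/2}/[p + (1-r)·ln n]^{1+p/2}, and if r ∈ [1,∞) then 𝕄 ∑_{i=1}^{n} i^{-r}·X_[i]^p ≤ C^p·(ln n)^{1+p/2}/(1 + (r-1)·ln n) + C^p·(ln n)^{p/2}; in each case the reverse inequality holds with C replaced by c. -/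

import Mathlib

open MeasureTheory ProbabilityTheory

/-- `decRe x` is the non-increasing rearrangement of `(|x_1|, …, |x_n|)`
(indexed from `0`, so `decRe x i = x_[i+1]` in the paper's notation). -/
noncomputable def decRe {n : ℕ} (x : Fin n → ℝ) : Fin n → ℝ :=
  fun i => |x (Tuple.sort (fun j => |x j|) i.rev)|

/-- The standard Gaussian measure `N(0, I_n)` on `ℝ^n`. -/
noncomputable def stdGaussian (n : ℕ) : Measure (Fin n → ℝ) :=
  Measure.pi fun _ => gaussianReal 0 1

/-- `m` is a median of `f` under `μ`. -/
def IsMedian {α : Type*} [MeasurableSpace α] (μ : Measure α) (f : α → ℝ) (m : ℝ) : Prop :=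
  (1 : ENNReal) / 2 ≤ μ {x | m ≤ f x} ∧ (1 : ENNReal) / 2 ≤ μ {x | f x ≤ m}

theorem sum_inv_eq_harmonic (n : ℕ) :
    ∑ i ∈ Finset.range n, ((i : ℝ) + 1)⁻¹ = (harmonic n : ℝ) := by
  simp [harmonic]

theorem rpow_neg_le_inv {x r : ℝ} (hx : 1 ≤ x) (hr : 1 ≤ r) : x ^ (-r) ≤ x⁻¹ := by
  rw [← Real.rpow_neg_one]
  exact Real.rpow_le_rpow_of_exponent_le hx (by linarith)

theorem mul_sum_rpow_neg_le {δ : ℝ} (hδ : 0 ≤ δ) (n : ℕ) :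
    δ * ∑ i ∈ Finset.range (n + 1), ((i : ℝ) + 1) ^ (-(1 + δ)) ≤
      δ + 1 - ((n : ℝ) + 1) ^ (-δ) := by
  induction n with
  | zero => simp
  | succ n ih =>
    rw [Finset.sum_range_succ, mul_add]
    push_cast
    have hx : (0 : ℝ) < n + 1 := by positivity
    have hy : (0 : ℝ) < n + 1 + 1 := by positivity
    have h1 : ((n : ℝ) + 1 + 1) ^ (-(1 + δ)) =
        ((n : ℝ) + 1 + 1) ^ (-δ) * ((n : ℝ) + 1 + 1)⁻¹ := by
      rw [← Real.rpow_neg_one (_ + _), ← Real.rpow_add hy]; congr 1; ring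
    have h2 : ((n : ℝ) + 1 + 1) ^ (-δ) * (1 + δ * ((n : ℝ) + 1 + 1)⁻¹) ≤ ((n : ℝ) + 1) ^ (-δ) := by
      have hlog := Real.one_sub_inv_le_log_of_pos (div_pos hy hx)
      have hinv : 1 - (((n : ℝ) + 1 + 1) / (n + 1))⁻¹ = ((n : ℝ) + 1 + 1)⁻¹ := by
        field_simp; ring
      rw [hinv, Real.log_div hy.ne' hx.ne'] at hlog
      rw [Real.rpow_def_of_pos hy, Real.rpow_def_of_pos hx]
      calc _ ≤ Real.exp (Real.log (n + 1 + 1) * -δ) *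
            Real.exp (δ * (Real.log (n + 1 + 1) - Real.log (n + 1))) := by
            gcongr
            refine le_trans ?_ (Real.add_one_le_exp _)
            nlinarith
        _ = _ := by rw [← Real.exp_add]; congr 1; ring
    rw [h1]
    linarith

theorem sum_rpow_neg_le {r : ℝ} (hr : 1 ≤ r) {n : ℕ} (hn : 1 ≤ n) :
    (∑ i ∈ Finset.range n, ((i : ℝ) + 1) ^ (-r) - 1) * (1 + (r - 1) * Real.log n) ≤
      2 * Real.log n := by
  have hL : 0 ≤ Real.log n := Real.log_natCast_nonneg n
  have h1 : ∑ i ∈ Finset.range n, ((i : ℝ) + 1) ^ (-r) ≤ 1 + Real.log n := by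
    refine le_trans ?_ (harmonic_le_one_add_log n)
    rw [← sum_inv_eq_harmonic]
    exact Finset.sum_le_sum fun i _ => rpow_neg_le_inv (by simp) hr
  have h2 := mul_sum_rpow_neg_le (sub_nonneg.2 hr) (n - 1)
  rw [Nat.sub_add_cancel hn, add_sub_cancel] at h2
  have h3 : 0 ≤ (((n - 1 : ℕ) : ℝ) + 1) ^ (-(r - 1)) := by positivity
  nlinarith

theorem mul_sum_rpow_sub_one_le {b : ℝ} (hb : 0 ≤ b) (hb1 : b ≤ 1) (n : ℕ) :
    b * ∑ i ∈ Finset.range n, ((i : ℝ) + 1) ^ (b - 1) ≤ (n : ℝ) ^ b := by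
  induction n with
  | zero => simp; positivity
  | succ n ih =>
    rw [Finset.sum_range_succ, mul_add]
    push_cast
    have hy : (0 : ℝ) < n + 1 := by positivity
    have h1 : (n : ℝ) ^ b ≤ ((n : ℝ) + 1) ^ b * (1 - b / (n + 1)) := by
      have h := rpow_one_add_le_one_add_mul_self (s := -1 / ((n : ℝ) + 1)) (p := b)
        (by rw [le_div_iff₀ hy]; linarith [(n.cast_nonneg : (0 : ℝ) ≤ n)]) hb hb1
      calc (n : ℝ) ^ b = ((n + 1) * (1 + -1 / ((n : ℝ) + 1))) ^ b := by
            congr 1; field_simp; ring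
        _ = ((n : ℝ) + 1) ^ b * (1 + -1 / ((n : ℝ) + 1)) ^ b := by
            rw [Real.mul_rpow hy.le]
            rw [show 1 + -1 / ((n : ℝ) + 1) = n / (n + 1) by field_simp; ring]
            positivity
        _ ≤ ((n : ℝ) + 1) ^ b * (1 + b * (-1 / ((n : ℝ) + 1))) := by gcongr
        _ = _ := by ring
    rw [Real.rpow_sub_one hy.ne']
    calc _ ≤ ((n : ℝ) + 1) ^ b * (1 - b / (n + 1)) + b * (((n : ℝ) + 1) ^ b / (n + 1)) := by
          linarith
      _ = _ := by ring

theorem sum_rpow_sub_one_le {b : ℝ} (hb : 0 ≤ b) (n : ℕ) :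
    ∑ i ∈ Finset.range n, ((i : ℝ) + 1) ^ (b - 1) ≤ (n : ℝ) ^ b * (1 + Real.log n) := by
  refine le_trans ?_ (mul_le_mul_of_nonneg_left (harmonic_le_one_add_log n) (by positivity))
  rw [← sum_inv_eq_harmonic, Finset.mul_sum]
  refine Finset.sum_le_sum fun i hi => ?_
  rw [Real.rpow_sub_one (by positivity), div_eq_mul_inv]
  gcongr
  exact_mod_cast Finset.mem_range.1 hi

theorem third_le_sum {δ u : ℝ} {k : ℕ} (hδ : 0 ≤ δ) (hu : 0 ≤ u) (hδu : δ * u ≤ 1)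
    (huk : Real.exp u ≤ k) :
    u / 3 ≤ ∑ i ∈ Finset.range k, ((i : ℝ) + 1) ^ (-(1 + δ)) := by
  set J := ⌊Real.exp u⌋₊
  have hJk : J ≤ k := Nat.floor_le_of_le huk
  have hJ : (J : ℝ) ≤ Real.exp u := Nat.floor_le (Real.exp_pos u).le
  have hu' : u ≤ harmonic J := by
    refine le_trans ?_ (log_add_one_le_harmonic J)
    rw [Real.le_log_iff_exp_le (by positivity)]
    push_cast
    exact (Nat.lt_floor_add_one _).le
  calc u / 3 ≤ Real.exp (-1) * u := by
        rw [Real.exp_neg, div_eq_inv_mul]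
        gcongr
        linarith [Real.exp_one_lt_d9]
    _ ≤ Real.exp (-(δ * u)) * ∑ i ∈ Finset.range J, ((i : ℝ) + 1)⁻¹ := by
        rw [sum_inv_eq_harmonic]; gcongr
    _ ≤ ∑ i ∈ Finset.range J, ((i : ℝ) + 1) ^ (-(1 + δ)) := by
        rw [Finset.mul_sum]
        refine Finset.sum_le_sum fun i hi => ?_
        have hi' : ((i : ℝ) + 1) ≤ Real.exp u :=
          le_trans (by exact_mod_cast Finset.mem_range.1 hi) hJ
        rw [neg_add, Real.rpow_add (by positivity), Real.rpow_neg_one, mul_comm]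
        gcongr
        rw [show -(δ * u) = u * (-δ) by ring, Real.exp_mul]
        exact Real.rpow_le_rpow_of_nonpos (by positivity) hi' (by linarith)
    _ ≤ _ := Finset.sum_le_sum_of_subset_of_nonneg (Finset.range_mono hJk)
        fun i _ _ => by positivity

theorem le_sum_of_exp_le {a M p x : ℝ} {k : ℕ} (ha : 0 ≤ a) (haM : a * M ≤ p) (hM : 16 ≤ M)
    (hx : Real.exp M ≤ x) (hk : x * Real.exp (-(M / 2)) ≤ k + 1) :
    x ^ a * Real.exp (-p) * (M / 4) ≤ ∑ i ∈ Finset.range k, ((i : ℝ) + 1) ^ (a - 1) := by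
  have hx0 : 0 < x := (Real.exp_pos M).trans_le hx
  set y := x * Real.exp (-M) with hy
  have hy1 : 1 ≤ y := by
    rw [hy, Real.exp_neg, ← div_eq_mul_inv, le_div_iff₀ (Real.exp_pos M)]; linarith
  have hy0 : 0 < y := by linarith
  set J := ⌊y⌋₊
  have hJ0 : 1 ≤ J := Nat.le_floor (by simpa using hy1)
  have hJ : (J : ℝ) ≤ y := Nat.floor_le hy0.le
  have hJ2 : y ≤ J + 1 := (Nat.lt_floor_add_one _).le
  have hharm : M / 4 ≤ (harmonic k : ℝ) - harmonic J := by
    have h1 := harmonic_le_one_add_log J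
    have h2 := log_add_one_le_harmonic k
    have h3 : Real.log J ≤ Real.log y := Real.log_le_log (by exact_mod_cast hJ0) hJ
    have h4 : Real.log (x * Real.exp (-(M / 2))) ≤ Real.log (↑(k + 1)) :=
      Real.log_le_log (by positivity) (by push_cast; exact hk)
    rw [Real.log_mul hx0.ne' (Real.exp_pos _).ne', Real.log_exp] at h4
    rw [hy, Real.log_mul hx0.ne' (Real.exp_pos _).ne', Real.log_exp] at h3
    linarith
  have hJk : J ≤ k := by
    by_contra! h
    have : (harmonic k : ℝ) ≤ harmonic J := by
      rw [← sum_inv_eq_harmonic, ← sum_inv_eq_harmonic]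
      exact Finset.sum_le_sum_of_subset_of_nonneg (Finset.range_mono h.le)
        fun i _ _ => by positivity
    linarith
  have hya : x ^ a * Real.exp (-p) ≤ y ^ a := by
    rw [hy, Real.mul_rpow hx0.le (Real.exp_pos _).le, ← Real.exp_mul]
    gcongr
    linarith
  calc _ ≤ y ^ a * ((harmonic k : ℝ) - harmonic J) := by gcongr
    _ = y ^ a * ∑ i ∈ Finset.Ico J k, ((i : ℝ) + 1)⁻¹ := by
        rw [Finset.sum_Ico_eq_sub _ hJk, sum_inv_eq_harmonic, sum_inv_eq_harmonic]
    _ ≤ ∑ i ∈ Finset.Ico J k, ((i : ℝ) + 1) ^ (a - 1) := by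
        rw [Finset.mul_sum]
        refine Finset.sum_le_sum fun i hi => ?_
        have : (J : ℝ) ≤ i := by exact_mod_cast (Finset.mem_Ico.1 hi).1
        rw [Real.rpow_sub_one (by positivity), div_eq_mul_inv]
        gcongr
        linarith
    _ ≤ _ := by
        rw [Finset.range_eq_Ico]
        exact Finset.sum_le_sum_of_subset_of_nonneg
          (Finset.Ico_subset_Ico_left (Nat.zero_le _)) fun i _ _ => by positivity

theorem rpow_le_sum {a : ℝ} (ha1 : a ≤ 1) (k : ℕ) (hk : 1 ≤ k) :
    (k : ℝ) ^ a ≤ ∑ i ∈ Finset.range k, ((i : ℝ) + 1) ^ (a - 1) := by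
  have hk0 : (0 : ℝ) < k := by exact_mod_cast hk
  calc (k : ℝ) ^ a = ∑ i ∈ Finset.range k, (k : ℝ) ^ (a - 1) := by
        rw [Finset.sum_const, Finset.card_range, nsmul_eq_mul, Real.rpow_sub_one hk0.ne']
        field_simp
    _ ≤ _ := Finset.sum_le_sum fun i hi =>
        Real.rpow_le_rpow_of_nonpos (by positivity)
          (by exact_mod_cast Finset.mem_range.1 hi) (by linarith)

theorem decRe_antitone {n : ℕ} (x : Fin n → ℝ) : Antitone (decRe x) :=
  fun _ _ hij => Tuple.monotone_sort (fun j => |x j|) (Fin.rev_le_rev.2 hij)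

theorem decRe_nonneg {n : ℕ} (x : Fin n → ℝ) (i : Fin n) : 0 ≤ decRe x i := abs_nonneg _

theorem sum_comp_decRe {n : ℕ} {M : Type*} [AddCommMonoid M] (g : ℝ → M) (x : Fin n → ℝ) :
    ∑ i, g (decRe x i) = ∑ j, g |x j| :=
  (Fin.revPerm.trans (Tuple.sort fun j => |x j|)).sum_comp fun j => g |x j|

theorem succ_mul_le_sum_comp {n : ℕ} {g : ℝ → ℝ} (hg : MonotoneOn g (Set.Ici 0))
    (hg0 : ∀ y, 0 ≤ g y) (x : Fin n → ℝ) (i : Fin n) :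
    ((i : ℝ) + 1) * g (decRe x i) ≤ ∑ j, g |x j| := by
  rw [← sum_comp_decRe g x]
  calc ((i : ℝ) + 1) * g (decRe x i) = ∑ _j ∈ Finset.Iic i, g (decRe x i) := by simp
    _ ≤ ∑ j ∈ Finset.Iic i, g (decRe x j) := Finset.sum_le_sum fun j hj =>
        hg (decRe_nonneg x i) (decRe_nonneg x j) (decRe_antitone x (Finset.mem_Iic.1 hj))
    _ ≤ _ := Finset.sum_le_sum_of_subset_of_nonneg (Finset.subset_univ _) fun j _ _ => hg0 _

theorem le_decRe_of_le_card {n k : ℕ} {x : Fin n → ℝ} {t : ℝ}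
    (hk : k ≤ ∑ j, if t ≤ |x j| then 1 else 0) {i : Fin n} (hi : (i : ℕ) < k) :
    t ≤ decRe x i := by
  by_contra! h
  rw [← sum_comp_decRe (fun y => if t ≤ y then 1 else 0) x, ← Finset.card_filter] at hk
  have hsub : Finset.univ.filter (fun j => t ≤ decRe x j) ⊆ Finset.Iio i := fun j hj => by
    rw [Finset.mem_Iio]
    by_contra! hij
    exact absurd ((Finset.mem_filter.1 hj).2.trans (decRe_antitone x hij)) (not_le.2 h)
  have := Finset.card_le_card hsub
  rw [Fin.card_Iio] at this
  lia

theorem IsMedian.le_of_forall_notMem {α : Type*} [MeasurableSpace α] {μ : Measure α}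
    [IsFiniteMeasure μ] {f : α → ℝ} {m U : ℝ} (h : IsMedian μ f m) {s : Set α}
    (hs : μ.real s < 1 / 2) (hU : ∀ x ∉ s, f x ≤ U) : m ≤ U := by
  by_contra! hm
  have h1 : μ {x | m ≤ f x} ≤ μ s := measure_mono fun x hx => by
    by_contra hxs
    exact absurd (hU x hxs) (not_le.2 (hm.trans_le hx))
  have h2 := ENNReal.toReal_mono (measure_ne_top _ _) (h.1.trans h1)
  norm_num [Measure.real] at h2 hs
  linarith

theorem IsMedian.ge_of_forall_notMem {α : Type*} [MeasurableSpace α] {μ : Measure α}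
    [IsFiniteMeasure μ] {f : α → ℝ} {m U : ℝ} (h : IsMedian μ f m) {s : Set α}
    (hs : μ.real s < 1 / 2) (hU : ∀ x ∉ s, U ≤ f x) : U ≤ m := by
  by_contra! hm
  have h1 : μ {x | f x ≤ m} ≤ μ s := measure_mono fun x hx => by
    by_contra hxs
    exact absurd (hU x hxs) (not_le.2 (lt_of_le_of_lt hx hm))
  have h2 := ENNReal.toReal_mono (measure_ne_top _ _) (h.2.trans h1)
  norm_num [Measure.real] at h2 hs
  linarith

instance (n : ℕ) : IsProbabilityMeasure (stdGaussian n) := by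
  unfold _root_.stdGaussian; infer_instance

theorem gaussianPDFReal_zero_one (x : ℝ) :
    gaussianPDFReal 0 1 x = (√(2 * Real.pi))⁻¹ * Real.exp (-x ^ 2 / 2) := by
  simp [gaussianPDFReal]

theorem inv_sqrt_two_pi_bounds :
    (39 / 100 : ℝ) ≤ (√(2 * Real.pi))⁻¹ ∧ (√(2 * Real.pi))⁻¹ ≤ 2 / 5 := by
  have h0 : 0 < √(2 * Real.pi) := by positivity
  have h1 : √(2 * Real.pi) ≤ 100 / 39 :=
    Real.sqrt_le_iff.2 ⟨by norm_num, by linarith [Real.pi_lt_d4]⟩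
  have h2 : 5 / 2 ≤ √(2 * Real.pi) := Real.le_sqrt_of_sq_le (by linarith [Real.pi_gt_d4])
  constructor
  · rw [le_inv_comm₀ (by norm_num) h0]; linarith
  · rw [inv_le_comm₀ h0 (by norm_num)]; linarith

theorem gaussianReal_real_eq_integral (s : Set ℝ) :
    (gaussianReal 0 1).real s = ∫ x in s, gaussianPDFReal 0 1 x := by
  rw [Measure.real, gaussianReal_apply_eq_integral _ one_ne_zero,
    ENNReal.toReal_ofReal (integral_nonneg fun x => gaussianPDFReal_nonneg _ _ x)]

theorem exp_neg_sq_le_gaussianReal_real_abs_ge (t : ℝ) :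
    (7 / 50) * Real.exp (-t ^ 2) ≤ (gaussianReal 0 1).real {y | t ≤ |y|} := by
  calc (7 / 50) * Real.exp (-t ^ 2)
      = ∫ _x in Set.Icc t (t + 1), (7 / 50) * Real.exp (-t ^ 2) := by simp
    _ ≤ ∫ x in Set.Icc t (t + 1), gaussianPDFReal 0 1 x := by
        refine setIntegral_mono_on (integrableOn_const (by simp))
          (integrable_gaussianPDFReal _ _).integrableOn measurableSet_Icc fun x hx => ?_
        rw [gaussianPDFReal_zero_one]
        have h1 : Real.exp (-1) * Real.exp (-t ^ 2) ≤ Real.exp (-x ^ 2 / 2) := by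
          rw [← Real.exp_add]
          gcongr
          nlinarith [hx.1, hx.2, sq_nonneg (t - 1)]
        have h2 : (9 / 25 : ℝ) ≤ Real.exp (-1) := by
          rw [Real.exp_neg, le_inv_comm₀ (by norm_num) (Real.exp_pos _)]
          linarith [Real.exp_one_lt_d9]
        calc 7 / 50 * Real.exp (-t ^ 2) ≤ 39 / 100 * (9 / 25 * Real.exp (-t ^ 2)) := by
              nlinarith [Real.exp_pos (-t ^ 2)]
          _ ≤ _ := by
              gcongr
              · exact inv_sqrt_two_pi_bounds.1
              · exact le_trans (by gcongr) h1
    _ = (gaussianReal 0 1).real (Set.Icc t (t + 1)) := (gaussianReal_real_eq_integral _).symm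
    _ ≤ _ := measureReal_mono fun x hx => le_trans hx.1 (le_abs_self x)

theorem le_gaussianReal_real_abs_ge :
    (97 / 100 : ℝ) ≤ (gaussianReal 0 1).real {y | 1 / 40 ≤ |y|} := by
  have hc : {y : ℝ | 1 / 40 ≤ |y|}ᶜ ⊆ Set.Icc (-(1 / 40)) (1 / 40) := fun y hy =>
    
    abs_le.1 (not_le.1 fun h => hy h).le
  have hm : MeasurableSet {y : ℝ | 1 / 40 ≤ |y|} := measurableSet_le (by fun_prop) (by fun_prop)
  have h1 : (gaussianReal 0 1).real (Set.Icc (-(1 / 40)) (1 / 40)) ≤ 2 / 100 := by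
    rw [gaussianReal_real_eq_integral]
    calc _ ≤ ∫ _x in Set.Icc (-(1 / 40) : ℝ) (1 / 40), (2 / 5 : ℝ) := by
          refine setIntegral_mono_on (integrable_gaussianPDFReal _ _).integrableOn (by simp)
            measurableSet_Icc fun x hx => ?_
          rw [gaussianPDFReal_zero_one]
          have := Real.exp_le_one_iff.2 (show -x ^ 2 / 2 ≤ 0 by nlinarith [sq_nonneg x])
          nlinarith [inv_sqrt_two_pi_bounds.1, inv_sqrt_two_pi_bounds.2]
      _ = _ := by simp; norm_num
  have h2 := probReal_compl_eq_one_sub (μ := gaussianReal 0 1) hm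
  have h3 := measureReal_mono (μ := gaussianReal 0 1) hc
  linarith

theorem integral_exp_sq_div_four :
    ∫ y, Real.exp (y ^ 2 / 4) ∂(gaussianReal 0 1) = √2 := by
  rw [integral_gaussianReal_eq_integral_smul one_ne_zero]
  have h : ∀ x : ℝ, gaussianPDFReal 0 1 x • Real.exp (x ^ 2 / 4) =
      (√(2 * Real.pi))⁻¹ * Real.exp (-(1 / 4) * x ^ 2) := fun x => by
    rw [gaussianPDFReal_zero_one, smul_eq_mul, mul_assoc, ← Real.exp_add]
    ring_nf
  simp_rw [h]
  rw [integral_const_mul, integral_gaussian, ← Real.sqrt_inv, ← Real.sqrt_mul (by positivity)]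
  congr 1
  field_simp
  norm_num

theorem stdGaussian_real_sum_exp_ge {n : ℕ} (hn : 0 < n) :
    (stdGaussian n).real {x | 4 * (n : ℝ) ≤ ∑ j, Real.exp (|x j| ^ 2 / 4)} < 1 / 2 := by
  have hint : Integrable (fun y => Real.exp (y ^ 2 / 4)) (gaussianReal 0 1) := by
    by_contra h
    have h1 := integral_exp_sq_div_four
    rw [integral_undef h] at h1
    exact (Real.sqrt_pos.2 two_pos).ne h1
  have hintj (j : Fin n) :
      Integrable (fun x : Fin n → ℝ => Real.exp (x j ^ 2 / 4)) (stdGaussian n) :=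
    (measurePreserving_eval (fun _ => gaussianReal 0 1) j).integrable_comp_of_integrable hint
  have hj (j : Fin n) : ∫ x, Real.exp (x j ^ 2 / 4) ∂(stdGaussian n) = √2 := by
    rw [← integral_exp_sq_div_four]
    exact integral_comp_eval (μ := fun _ : Fin n => gaussianReal 0 1) hint.aestronglyMeasurable
  have h := mul_meas_ge_le_integral_of_nonneg (μ := stdGaussian n)
    (f := fun x => ∑ j, Real.exp (x j ^ 2 / 4)) (Filter.Eventually.of_forall fun x => by positivity)
    (integrable_finsetSum _ fun j _ => hintj j) (4 * n)
  rw [integral_finsetSum _ fun j _ => hintj j] at h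
  simp_rw [hj] at h
  simp only [Finset.sum_const, Finset.card_univ, Fintype.card_fin, nsmul_eq_mul] at h
  simp only [sq_abs]
  have hn' : (0 : ℝ) < n := by exact_mod_cast hn
  have h2 : √2 < 2 := by rw [Real.sqrt_lt' (by norm_num)]; norm_num
  by_contra! hge
  nlinarith

theorem integral_ite_exp_neg_one_le (t : ℝ) :
    ∫ y, (if t ≤ |y| then Real.exp (-1) else 1) ∂(gaussianReal 0 1) ≤
      Real.exp (-(63 / 100 * (gaussianReal 0 1).real {y | t ≤ |y|})) := by
  have hm : MeasurableSet {y : ℝ | t ≤ |y|} := measurableSet_le (by fun_prop) (by fun_prop)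
  have h : ∀ y : ℝ, (if t ≤ |y| then Real.exp (-1) else 1) =
      1 - {y : ℝ | t ≤ |y|}.indicator (fun _ => 1 - Real.exp (-1)) y := fun y => by
    by_cases hy : t ≤ |y| <;> simp [hy]
  simp_rw [h]
  rw [integral_sub (integrable_const _) ((integrable_const _).indicator hm),
    integral_indicator_const _ hm]
  simp only [integral_const, probReal_univ, smul_eq_mul, one_mul]
  refine le_trans ?_ (Real.one_sub_le_exp_neg _)
  have h2 : Real.exp (-1) ≤ 37 / 100 := by
    rw [Real.exp_neg, inv_le_comm₀ (Real.exp_pos _) (by norm_num)]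
    linarith [Real.exp_one_gt_d9]
  nlinarith [measureReal_nonneg (μ := gaussianReal 0 1) (s := {y : ℝ | t ≤ |y|})]

theorem stdGaussian_real_card_lt {n k : ℕ} {t : ℝ}
    (h : (k : ℝ) - 3 / 10 ≤ 63 / 100 * (n * (gaussianReal 0 1).real {y | t ≤ |y|})) :
    (stdGaussian n).real {x | (∑ j, if t ≤ |x j| then 1 else 0) < k} < 1 / 2 := by
  set q := (gaussianReal 0 1).real {y | t ≤ |y|}
  set g : ℝ → ℝ := fun y => if t ≤ |y| then Real.exp (-1) else 1
  have hg0 : ∀ y, 0 ≤ g y := fun y => by dsimp only [g]; split_ifs <;> positivity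
  have hprod (x : Fin n → ℝ) :
      ∏ j, g (x j) = Real.exp (-((∑ j, if t ≤ |x j| then 1 else 0 : ℕ) : ℝ)) := by
    push_cast
    rw [← Finset.sum_neg_distrib, Real.exp_sum]
    refine Finset.prod_congr rfl fun j _ => ?_
    by_cases hy : t ≤ |x j| <;> simp [g, hy]
  have hgm : Measurable g := Measurable.ite (measurableSet_le (by fun_prop) (by fun_prop))
    measurable_const measurable_const
  have hint : Integrable g (gaussianReal 0 1) :=
    Integrable.of_bound hgm.aestronglyMeasurable 1 (Filter.Eventually.of_forall fun y => by
      rw [Real.norm_of_nonneg (hg0 y)]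
      dsimp only [g]
      split_ifs
      · exact Real.exp_le_one_iff.2 (by norm_num)
      · exact le_rfl)
  have hmk := mul_meas_ge_le_integral_of_nonneg (μ := stdGaussian n)
    (f := fun x => ∏ j, g (x j))
    (Filter.Eventually.of_forall fun x => Finset.prod_nonneg fun j _ => hg0 _)
    (Integrable.fintype_prod fun _ => hint) (Real.exp (-((k : ℝ) - 1)))
  have hI : ∫ x, ∏ j, g (x j) ∂(stdGaussian n) ≤ Real.exp (-(63 / 100 * (n * q))) := by
    rw [_root_.stdGaussian, integral_fintype_prod_eq_pow g, Fintype.card_fin]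
    calc _ ≤ Real.exp (-(63 / 100 * q)) ^ n := by
          exact pow_le_pow_left₀ (integral_nonneg hg0) (integral_ite_exp_neg_one_le t) n
      _ = _ := by rw [← Real.exp_nat_mul]; congr 1; ring
  have hsub : {x : Fin n → ℝ | (∑ j, if t ≤ |x j| then 1 else 0) < k} ⊆
      {x | Real.exp (-((k : ℝ) - 1)) ≤ ∏ j, g (x j)} := fun x hx => by
    rw [Set.mem_ofPred_eq, hprod]
    have : ((∑ j, if t ≤ |x j| then 1 else 0 : ℕ) : ℝ) + 1 ≤ k := by exact_mod_cast hx
    gcongr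
    linarith
  have hP := measureReal_mono (μ := stdGaussian n) hsub
  have hexp : Real.exp (-(7 / 10)) < 1 / 2 := by
    rw [← Real.lt_log_iff_exp_lt (by norm_num), one_div, Real.log_inv]
    linarith [Real.log_two_lt_d9]
  have hle : Real.exp (-(63 / 100 * (n * q))) ≤
      Real.exp (-(7 / 10)) * Real.exp (-((k : ℝ) - 1)) := by
    rw [← Real.exp_add]
    gcongr
    linarith
  have hpos := Real.exp_pos (-((k : ℝ) - 1))
  refine hP.trans_lt ?_
  by_contra! hge
  nlinarith

theorem IsMedian.le_sum_log {n : ℕ} (hn : 0 < n) {r p m : ℝ} (hp : 0 ≤ p)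
    (h : IsMedian (stdGaussian n)
      (fun x => ∑ i : Fin n, ((i : ℝ) + 1) ^ (-r) * decRe x i ^ p) m) :
    m ≤ 2 ^ p * ∑ i ∈ Finset.range n,
      ((i : ℝ) + 1) ^ (-r) * Real.log (4 * n / (i + 1)) ^ (p / 2) := by
  refine h.le_of_forall_notMem (stdGaussian_real_sum_exp_ge hn) fun x hx => ?_
  rw [← Fin.sum_univ_eq_sum_range
    (fun i : ℕ => ((i : ℝ) + 1) ^ (-r) * Real.log (4 * n / (i + 1)) ^ (p / 2)) n, Finset.mul_sum]
  refine Finset.sum_le_sum fun i _ => ?_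
  rw [mul_left_comm]
  gcongr
  have h0 := decRe_nonneg x i
  have hi : (0 : ℝ) < i + 1 := by positivity
  have h1 := succ_mul_le_sum_comp (g := fun y => Real.exp (y ^ 2 / 4))
    (fun a ha b hb hab => by
      have : (0 : ℝ) ≤ a := ha
      dsimp only; gcongr) (fun y => by positivity) x i
  have h2 : Real.exp (decRe x i ^ 2 / 4) ≤ 4 * n / (i + 1) := by
    rw [le_div_iff₀ hi, mul_comm]
    exact h1.trans (not_le.1 hx).le
  have h3 := (Real.le_log_iff_exp_le (by positivity)).2 h2
  have h4 : decRe x i ^ p ≤ (4 * Real.log (4 * n / (i + 1))) ^ (p / 2) := by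
    calc decRe x i ^ p = (decRe x i ^ 2) ^ (p / 2) := by
          rw [← Real.rpow_natCast, ← Real.rpow_mul h0]; congr 1; push_cast; ring
      _ ≤ _ := by gcongr; linarith
  have h5 : 0 ≤ Real.log (4 * n / (i + 1)) := le_trans (by positivity) h3
  refine h4.trans_eq ?_
  rw [Real.mul_rpow (by norm_num) h5]
  congr 1
  rw [show (4 : ℝ) = 2 ^ (2 : ℝ) by norm_num, ← Real.rpow_mul (by norm_num)]
  congr 1; ring

theorem IsMedian.rpow_mul_sum_le {n k : ℕ} {r p m t : ℝ} (hp : 0 ≤ p) (ht : 0 ≤ t) (hkn : k ≤ n)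
    (hk : (k : ℝ) - 3 / 10 ≤ 63 / 100 * (n * (gaussianReal 0 1).real {y | t ≤ |y|}))
    (h : IsMedian (stdGaussian n)
      (fun x => ∑ i : Fin n, ((i : ℝ) + 1) ^ (-r) * decRe x i ^ p) m) :
    t ^ p * ∑ i ∈ Finset.range k, ((i : ℝ) + 1) ^ (-r) ≤ m := by
  refine h.ge_of_forall_notMem (stdGaussian_real_card_lt hk) fun x hx => ?_
  have hx' : k ≤ ∑ j, if t ≤ |x j| then 1 else 0 := not_lt.1 fun h => hx h
  calc t ^ p * ∑ i ∈ Finset.range k, ((i : ℝ) + 1) ^ (-r)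
      = ∑ i : Fin k, ((i : ℝ) + 1) ^ (-r) * t ^ p := by
        rw [← Fin.sum_univ_eq_sum_range (fun i : ℕ => ((i : ℝ) + 1) ^ (-r)) k, mul_comm,
          Finset.sum_mul]
    _ ≤ ∑ i : Fin k, ((i : ℝ) + 1) ^ (-r) * decRe x (Fin.castLE hkn i) ^ p := by
        gcongr with i
        exact le_decRe_of_le_card hx' (by simp)
    _ = ∑ i ∈ Finset.univ.map (Fin.castLEEmb hkn),
          (((i : ℕ) : ℝ) + 1) ^ (-r) * decRe x i ^ p := by
        simp
    _ ≤ _ := Finset.sum_le_sum_of_subset_of_nonneg (Finset.subset_univ _) fun i _ _ =>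
        mul_nonneg (by positivity) (Real.rpow_nonneg (decRe_nonneg x i) _)

theorem half_le_log_natCast {n : ℕ} (hn : 2 ≤ n) : 1 / 2 ≤ Real.log n := by
  have : Real.log 2 ≤ Real.log n := Real.log_le_log two_pos (by exact_mod_cast hn)
  linarith [Real.log_two_gt_d9]

theorem log_four_mul_le {n : ℕ} (hn : 2 ≤ n) : Real.log (4 * n) ≤ 3 * Real.log n := by
  have hn' : (2 : ℝ) ≤ n := by exact_mod_cast hn
  have hn0 : (0 : ℝ) ≤ n := n.cast_nonneg
  rw [show (3 : ℝ) = (3 : ℕ) by norm_num, ← Real.log_pow]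
  exact Real.log_le_log (by positivity)
    (by nlinarith [mul_nonneg hn0 (show (0 : ℝ) ≤ n ^ 2 - 4 by nlinarith)])

theorem log_four_mul_div_bounds {n i : ℕ} (hn : 2 ≤ n) (hi : i < n) :
    0 ≤ Real.log (4 * n / (i + 1)) ∧ Real.log (4 * n / (i + 1)) ≤ 3 * Real.log n := by
  have hi' : (i : ℝ) + 1 ≤ n := by exact_mod_cast hi
  constructor
  · refine Real.log_nonneg ?_
    rw [one_le_div (by positivity)]
    linarith
  · refine le_trans (Real.log_le_log (by positivity) ?_) (log_four_mul_le hn)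
    exact div_le_self (by positivity) (by simp)

theorem sum_rpow_mul_log_rpow_le {a p : ℝ} {n : ℕ} (ha : 0 ≤ a) (ha1 : a ≤ 1) (hp : 1 ≤ p)
    (hn : 2 ≤ n) :
    ∑ i ∈ Finset.range n, ((i : ℝ) + 1) ^ (a - 1) * Real.log (4 * n / (i + 1)) ^ (p / 2) ≤
      10 * (n : ℝ) ^ a * (3 * (p * Real.log n / (p + a * Real.log n))) ^ (p / 2) *
        (p * Real.log n / (p + a * Real.log n)) := by
  have hL := half_le_log_natCast hn
  set L := Real.log n
  have hpa : 0 < p + a * L := by positivity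
  set M := p * L / (p + a * L) with hM
  have hM0 : 0 < M := by positivity
  have hn0 : (0 : ℝ) < n := by positivity
  set D := ∑ i ∈ Finset.range n, ((i : ℝ) + 1) ^ (a / 2 - 1)
  have hna : 0 < (n : ℝ) ^ (a / 2) := by positivity
  have hD : D ≤ 5 * (n : ℝ) ^ (a / 2) * M := by
    have h1 : a / 2 * D ≤ (n : ℝ) ^ (a / 2) :=
      mul_sum_rpow_sub_one_le (by positivity) (by linarith) n
    have h2 : D ≤ (n : ℝ) ^ (a / 2) * (1 + L) := sum_rpow_sub_one_le (by positivity) n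
    have h3 : D ≤ (n : ℝ) ^ (a / 2) * (3 * L) := h2.trans (by gcongr; linarith)
    rw [hM, ← mul_div_assoc, le_div_iff₀ hpa]
    have h4 : D * p ≤ (n : ℝ) ^ (a / 2) * (3 * L) * p := by gcongr
    have h5 : a / 2 * D * (2 * L) ≤ (n : ℝ) ^ (a / 2) * (2 * L) := by gcongr
    have h6 : (n : ℝ) ^ (a / 2) * (2 * L) * 1 ≤ (n : ℝ) ^ (a / 2) * (2 * L) * p := by gcongr
    linarith
  have hterm : ∀ i ∈ Finset.range n,
      ((i : ℝ) + 1) ^ (a - 1) * Real.log (4 * n / (i + 1)) ^ (p / 2) ≤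
        (3 * M) ^ (p / 2) * (4 * n) ^ (a / 2) * ((i : ℝ) + 1) ^ (a / 2 - 1) := fun i hi => by
    obtain ⟨ht0, ht⟩ := log_four_mul_div_bounds hn (Finset.mem_range.1 hi)
    have hi0 : (0 : ℝ) < i + 1 := by positivity
    set t := Real.log (4 * n / (i + 1)) with ht_def
    have h1 : t ≤ 3 * M * Real.exp (a * t / p) := by
      calc t ≤ 3 * M * (a * t / p + 1) := by
            have : 3 * M * (a * t / p + 1) = 3 * L * (a * t + p) / (p + a * L) := by
              rw [hM]; field_simp
            rw [this, le_div_iff₀ hpa]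
            have : 0 ≤ t * a * L := by positivity
            nlinarith
        _ ≤ _ := by gcongr; exact Real.add_one_le_exp _
    have h2 : t ^ (p / 2) ≤ (3 * M) ^ (p / 2) * (4 * n / (i + 1)) ^ (a / 2) := by
      refine (Real.rpow_le_rpow ht0 h1 (by positivity)).trans_eq ?_
      rw [Real.mul_rpow (by positivity) (by positivity), ← Real.exp_mul,
        Real.rpow_def_of_pos (x := 4 * n / (i + 1)) (by positivity), ← ht_def]
      congr 2
      field_simp
    refine (mul_le_mul_of_nonneg_left h2 (by positivity)).trans_eq ?_
    rw [Real.div_rpow (by positivity) hi0.le, show a - 1 = (a / 2 - 1) + a / 2 by ring,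
      Real.rpow_add hi0]
    field_simp
  calc _ ≤ (3 * M) ^ (p / 2) * (4 * n) ^ (a / 2) * D := by
        rw [Finset.mul_sum]; exact Finset.sum_le_sum hterm
    _ ≤ (3 * M) ^ (p / 2) * (2 * (n : ℝ) ^ (a / 2)) * (5 * (n : ℝ) ^ (a / 2) * M) := by
        gcongr
        rw [Real.mul_rpow (by norm_num) hn0.le]
        gcongr
        calc (4 : ℝ) ^ (a / 2) ≤ 4 ^ (1 / 2 : ℝ) := by gcongr; norm_num
          _ = 2 := by
            rw [← Real.sqrt_eq_rpow, show (4 : ℝ) = 2 ^ 2 by norm_num]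
            exact Real.sqrt_sq (by norm_num)
    _ = _ := by
        rw [show (n : ℝ) ^ a = (n : ℝ) ^ (a / 2) * (n : ℝ) ^ (a / 2) by
          rw [← Real.rpow_add hn0, add_halves]]
        ring

theorem self_le_rpow_self {b x : ℝ} (hb : 1 ≤ b) (hx : 1 ≤ x) : b ≤ b ^ x := by
  simpa using Real.rpow_le_rpow_of_exponent_le hb hx

theorem le_two_rpow {p : ℝ} (hp : 1 ≤ p) : p ≤ 2 ^ p := by
  have := one_add_mul_self_le_rpow_one_add (s := 1) (by norm_num) hp
  norm_num at this
  linarith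

theorem three_rpow_half_le {p : ℝ} (hp : 1 ≤ p) : (3 : ℝ) ^ (p / 2) ≤ 2 ^ p := by
  rw [show (2 : ℝ) ^ p = 4 ^ (p / 2) by
    rw [show (4 : ℝ) = 2 ^ (2 : ℝ) by norm_num, ← Real.rpow_mul (by norm_num)]; congr 1; ring]
  gcongr
  norm_num

theorem rpow_half_div_two {M p : ℝ} (hM : 0 ≤ M) : (√M / 2) ^ p = M ^ (p / 2) / 2 ^ p := by
  rw [Real.div_rpow (Real.sqrt_nonneg _) (by norm_num), Real.sqrt_eq_rpow, ← Real.rpow_mul hM]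
  congr 2
  ring

theorem two_mul_sixteen_rpow_le {p : ℝ} (hp : 1 ≤ p) :
    2 * (1 / 5120 : ℝ) ^ p * 16 ^ (1 + p / 2) ≤ (1 / 40) ^ p := by
  rw [Real.rpow_add (by norm_num), Real.rpow_one, show (16 : ℝ) ^ (p / 2) = 4 ^ p by
    rw [show (16 : ℝ) = 4 ^ (2 : ℝ) by norm_num, ← Real.rpow_mul (by norm_num)]; congr 1; ring,
    show (1 / 40 : ℝ) = (1 / 5120) * 32 * 4 by norm_num, Real.mul_rpow (by norm_num) (by norm_num),
    Real.mul_rpow (by norm_num) (by norm_num)]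
  have h := self_le_rpow_self (b := 32) (by norm_num) hp
  calc 2 * (1 / 5120 : ℝ) ^ p * (16 * 4 ^ p) = (1 / 5120 : ℝ) ^ p * 32 * 4 ^ p := by ring
    _ ≤ _ := by gcongr

theorem IsMedian.ge_of_half {n : ℕ} (hn : 2 ≤ n) {r p m : ℝ} (hp : 0 ≤ p)
    (h : IsMedian (stdGaussian n)
      (fun x => ∑ i : Fin n, ((i : ℝ) + 1) ^ (-r) * decRe x i ^ p) m) :
    (1 / 40) ^ p * ∑ i ∈ Finset.range ((n + 1) / 2), ((i : ℝ) + 1) ^ (-r) ≤ m := by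
  refine h.rpow_mul_sum_le hp (by norm_num) (by lia) ?_
  have h1 : (((n + 1) / 2 : ℕ) : ℝ) ≤ (n + 1) / 2 := by
    simpa using Nat.cast_div_le (α := ℝ) (m := n + 1) (n := 2)
  have h2 : (2 : ℝ) ≤ n := by exact_mod_cast hn
  nlinarith [le_gaussianReal_real_abs_ge]

theorem IsMedian.ge_of_exp {n k : ℕ} {r p m M : ℝ} (hp : 0 ≤ p) (hM : 16 ≤ M)
    (hk : (k : ℝ) ≤ n * Real.exp (-(M / 2)))
    (h : IsMedian (stdGaussian n)
      (fun x => ∑ i : Fin n, ((i : ℝ) + 1) ^ (-r) * decRe x i ^ p) m) :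
    M ^ (p / 2) / 2 ^ p * ∑ i ∈ Finset.range k, ((i : ℝ) + 1) ^ (-r) ≤ m := by
  rw [← rpow_half_div_two (by linarith)]
  refine h.rpow_mul_sum_le hp (by positivity) ?_ ?_
  · have : (k : ℝ) ≤ n := hk.trans
      (mul_le_of_le_one_right (by positivity) (Real.exp_le_one_iff.2 (by linarith)))
    exact_mod_cast this
  · have h1 := exp_neg_sq_le_gaussianReal_real_abs_ge (√M / 2)
    rw [div_pow, Real.sq_sqrt (by linarith)] at h1
    have h2 : Real.exp (-(M / 2)) ≤ 2 / 25 * Real.exp (-(M / 2 ^ 2)) := by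
      rw [show -(M / 2) = -(M / 4) + -(M / 2 ^ 2) by ring, Real.exp_add]
      gcongr
      rw [Real.exp_neg, inv_le_comm₀ (Real.exp_pos _) (by norm_num)]
      have h3 : (2 : ℝ) ^ 4 ≤ Real.exp 1 ^ 4 := by gcongr; linarith [Real.exp_one_gt_d9]
      rw [← Real.exp_nat_mul] at h3
      refine le_trans ?_ (h3.trans (Real.exp_le_exp.2 ?_))
      · norm_num
      · push_cast; linarith
    have hn0 : (0 : ℝ) ≤ n := by positivity
    have h4 : (n : ℝ) * Real.exp (-(M / 2)) ≤ n * (2 / 25 * Real.exp (-(M / 2 ^ 2))) := by gcongr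
    have h5 : (n : ℝ) * (7 / 50 * Real.exp (-(M / 2 ^ 2))) ≤
        n * (gaussianReal 0 1).real {y | √M / 2 ≤ |y|} := by gcongr
    nlinarith

theorem IsMedian.bounds_of_le_one {a p m : ℝ} {n : ℕ} (ha : 0 ≤ a) (ha1 : a ≤ 1) (hp : 1 ≤ p)
    (hn : 2 ≤ n)
    (h : IsMedian (stdGaussian n)
      (fun x => ∑ i : Fin n, ((i : ℝ) + 1) ^ (-(1 - a)) * decRe x i ^ p) m) :
    (1 / 5120) ^ p *
        ((n : ℝ) ^ a * (p * Real.log n / (p + a * Real.log n)) ^ (1 + p / 2) / p) ≤ m ∧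
      m ≤ 80 ^ p *
        ((n : ℝ) ^ a * (p * Real.log n / (p + a * Real.log n)) ^ (1 + p / 2) / p) := by
  have hL := half_le_log_natCast hn
  have hub := sum_rpow_mul_log_rpow_le ha ha1 hp hn
  have hmu := h.le_sum_log (by lia) (by linarith)
  have hhalf := h.ge_of_half hn (by linarith)
  have hexp := fun (k : ℕ) (M : ℝ) hM hk => h.ge_of_exp (k := k) (M := M) (by linarith) hM hk
  simp only [neg_sub] at hmu hhalf hexp
  set L := Real.log n with hL_def
  have hpa : 0 < p + a * L := by positivity
  set M := p * L / (p + a * L) with hM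
  have hM0 : 0 < M := by positivity
  have hML : M ≤ L := by
    rw [hM, div_le_iff₀ hpa]
    nlinarith [mul_nonneg ha (sq_nonneg L)]
  have haM : a * M ≤ p := by
    rw [hM, ← mul_div_assoc, div_le_iff₀ hpa]
    nlinarith
  have hn0 : (0 : ℝ) < n := by positivity
  constructor
  · refine (mul_le_mul_of_nonneg_left (div_le_self (by positivity) hp) (by positivity)).trans ?_
    rcases le_total M 16 with hM16 | hM16
    · refine le_trans ?_ hhalf
      have h1 := rpow_le_sum ha1 ((n + 1) / 2) (by lia)
      have h2 : (n : ℝ) ^ a / 2 ≤ (((n + 1) / 2 : ℕ) : ℝ) ^ a := by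
        calc (n : ℝ) ^ a / 2 ≤ (n : ℝ) ^ a / 2 ^ a := by
              gcongr
              simpa using Real.rpow_le_rpow_of_exponent_le (x := 2) (by norm_num) ha1
          _ = ((n : ℝ) / 2) ^ a := (Real.div_rpow hn0.le (by norm_num) _).symm
          _ ≤ _ := by
              gcongr
              rw [div_le_iff₀ (by norm_num)]
              exact_mod_cast (show n ≤ (n + 1) / 2 * 2 by lia)
      calc (1 / 5120) ^ p * ((n : ℝ) ^ a * M ^ (1 + p / 2))
          ≤ (1 / 5120) ^ p * ((n : ℝ) ^ a * 16 ^ (1 + p / 2)) := by gcongr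
        _ = 2 * (1 / 5120) ^ p * 16 ^ (1 + p / 2) * ((n : ℝ) ^ a / 2) := by ring
        _ ≤ _ := by
            gcongr
            · exact two_mul_sixteen_rpow_le hp
            · exact h2.trans h1
    · set k := ⌊n * Real.exp (-(M / 2))⌋₊
      refine le_trans ?_ (hexp k M hM16 (Nat.floor_le (by positivity)))
      have hsum := le_sum_of_exp_le (x := n) (k := k) ha haM hM16
        (by rwa [← Real.le_log_iff_exp_le hn0]) (Nat.lt_floor_add_one _).le
      have he : (1 / 3 : ℝ) ^ p ≤ Real.exp (-p) := by
        rw [← neg_one_mul, Real.exp_mul, Real.exp_neg]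
        gcongr
        rw [one_div]
        gcongr
        linarith [Real.exp_one_lt_d9]
      have h4 : (1 / 4 : ℝ) ^ p ≤ 1 / 4 := by
        simpa using Real.rpow_le_rpow_of_exponent_ge (x := 1 / 4) (by norm_num) (by norm_num) hp
      calc (1 / 5120) ^ p * ((n : ℝ) ^ a * M ^ (1 + p / 2))
          ≤ (1 / 2 * (1 / 3) * (1 / 4)) ^ p * ((n : ℝ) ^ a * M ^ (1 + p / 2)) := by
            gcongr; norm_num
        _ = (1 / 2) ^ p * (1 / 3) ^ p * (1 / 4) ^ p * ((n : ℝ) ^ a * (M * M ^ (p / 2))) := by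
            rw [Real.mul_rpow (by norm_num) (by norm_num),
              Real.mul_rpow (by norm_num) (by norm_num), Real.rpow_add hM0, Real.rpow_one]
        _ ≤ (1 / 2) ^ p * Real.exp (-p) * (1 / 4) * ((n : ℝ) ^ a * (M * M ^ (p / 2))) := by
            gcongr
        _ = M ^ (p / 2) / 2 ^ p * ((n : ℝ) ^ a * Real.exp (-p) * (M / 4)) := by
            rw [Real.div_rpow (by norm_num) (by norm_num), Real.one_rpow]; ring
        _ ≤ _ := by gcongr
  · calc m ≤ 2 ^ p * (10 * (n : ℝ) ^ a * (3 * M) ^ (p / 2) * M) := hmu.trans (by gcongr)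
      _ = 2 ^ p * 3 ^ (p / 2) * 10 * p * ((n : ℝ) ^ a * M ^ (1 + p / 2) / p) := by
          rw [Real.mul_rpow (by norm_num) hM0.le, Real.rpow_add hM0, Real.rpow_one]
          field_simp
      _ ≤ 2 ^ p * 2 ^ p * 10 ^ p * 2 ^ p * ((n : ℝ) ^ a * M ^ (1 + p / 2) / p) := by
          gcongr
          · exact three_rpow_half_le hp
          · exact self_le_rpow_self (by norm_num) hp
          · exact le_two_rpow hp
      _ = _ := by
          rw [← Real.mul_rpow (by norm_num) (by norm_num),
            ← Real.mul_rpow (by norm_num) (by norm_num),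
            ← Real.mul_rpow (by norm_num) (by norm_num)]
          norm_num

theorem IsMedian.bounds_of_one_le {δ p m : ℝ} {n : ℕ} (hδ : 0 ≤ δ) (hp : 1 ≤ p) (hn : 2 ≤ n)
    (h : IsMedian (stdGaussian n)
      (fun x => ∑ i : Fin n, ((i : ℝ) + 1) ^ (-(1 + δ)) * decRe x i ^ p) m) :
    (1 / 5120) ^ p * (Real.log n ^ (p / 2) * (Real.log n / (1 + δ * Real.log n) + 1)) ≤ m ∧
      m ≤ 80 ^ p * (Real.log n ^ (p / 2) * (Real.log n / (1 + δ * Real.log n) + 1)) := by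
  have hL := half_le_log_natCast hn
  have hub := sum_rpow_neg_le (r := 1 + δ) (by linarith) (show 1 ≤ n by lia)
  rw [add_sub_cancel_left] at hub
  have hmu := h.le_sum_log (by lia) (by linarith)
  have hhalf := h.ge_of_half hn (by linarith)
  have hlog := fun i (hi : i ∈ Finset.range n) => log_four_mul_div_bounds hn (Finset.mem_range.1 hi)
  have hn0 : (0 : ℝ) < n := by positivity
  have hfirst {k : ℕ} (hk : 1 ≤ k) :
      1 ≤ ∑ i ∈ Finset.range k, ((i : ℝ) + 1) ^ (-(1 + δ)) := by
    refine le_trans ?_ (Finset.single_le_sum (f := fun i : ℕ => ((i : ℝ) + 1) ^ (-(1 + δ)))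
      (fun i _ => by positivity) (Finset.mem_range.2 hk))
    simp
  have hexp := fun (k : ℕ) hM hk => h.ge_of_exp (k := k) (M := Real.log n) (by linarith) hM hk
  set L := Real.log n with hL_def
  have hd : 0 < 1 + δ * L := by positivity
  set M := L / (1 + δ * L) with hM
  have hM0 : 0 < M := by positivity
  have hML : M ≤ L := div_le_self (by positivity) (by nlinarith)
  constructor
  · rcases le_total L 16 with hL16 | hL16
    · refine le_trans ?_ hhalf
      calc (1 / 5120) ^ p * (L ^ (p / 2) * (M + 1))
          ≤ (1 / 5120) ^ p * (16 ^ (p / 2) * (16 + 16)) := by gcongr <;> linarith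
        _ = 2 * (1 / 5120) ^ p * 16 ^ (1 + p / 2) * 1 := by
            rw [Real.rpow_add (by norm_num), Real.rpow_one]; ring
        _ ≤ _ := by
            gcongr
            · exact two_mul_sixteen_rpow_le hp
            · exact hfirst (by lia)
    · set k := ⌊n * Real.exp (-(L / 2))⌋₊
      have hx : n * Real.exp (-(L / 2)) = Real.exp (L / 2) := by
        conv_lhs => rw [← Real.exp_log hn0, ← Real.exp_add]
        congr 1; ring
      refine le_trans ?_ (hexp k hL16 (Nat.floor_le (by positivity)))
      have hk : Real.exp (L / 4) ≤ k := by
        have h1 := Nat.sub_one_lt_floor (n * Real.exp (-(L / 2)))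
        rw [hx, show L / 2 = L / 4 + L / 4 by ring, Real.exp_add] at h1
        have h2 := Real.add_one_le_exp (L / 4)
        have h3 : (k : ℝ) = ⌊n * Real.exp (-(L / 2))⌋₊ := rfl
        rw [hx, show L / 2 = L / 4 + L / 4 by ring, Real.exp_add] at h3
        nlinarith
      have hM4 : M / 4 ≤ L / 4 := by linarith
      have hS := third_le_sum (u := M / 4) (k := k) hδ (by positivity)
        (by
          rw [hM, div_div, ← mul_div_assoc, div_le_one (by positivity)]
          nlinarith [mul_nonneg hδ (show 0 ≤ L by linarith)])
        ((Real.exp_le_exp.2 hM4).trans hk)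
      have hS1 := hfirst (k := k) (by
        have h1 := (Real.one_le_exp (show 0 ≤ L / 4 by linarith)).trans hk
        exact_mod_cast h1)
      set S := ∑ i ∈ Finset.range k, ((i : ℝ) + 1) ^ (-(1 + δ))
      have h24 : (1 / 24 : ℝ) ^ p ≤ 1 / 24 := by
        simpa using Real.rpow_le_rpow_of_exponent_ge (x := 1 / 24) (by norm_num) (by norm_num) hp
      calc (1 / 5120) ^ p * (L ^ (p / 2) * (M + 1))
          ≤ (1 / 2 * (1 / 24)) ^ p * (L ^ (p / 2) * (M + 1)) := by gcongr; norm_num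
        _ = (1 / 2) ^ p * (1 / 24) ^ p * (L ^ (p / 2) * (M + 1)) := by
            rw [Real.mul_rpow (by norm_num) (by norm_num)]
        _ ≤ (1 / 2) ^ p * (1 / 24) * (L ^ (p / 2) * (M + 1)) := by gcongr
        _ = L ^ (p / 2) / 2 ^ p * ((M + 1) / 24) := by
            rw [Real.div_rpow (by norm_num) (by norm_num), Real.one_rpow]; ring
        _ ≤ _ := by gcongr; linarith
  · have hS : ∑ i ∈ Finset.range n, ((i : ℝ) + 1) ^ (-(1 + δ)) ≤ 2 * (M + 1) := by
      rw [← le_div_iff₀ hd, mul_div_assoc] at hub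
      linarith
    calc m ≤ 2 ^ p * ((3 * L) ^ (p / 2) * (2 * (M + 1))) := by
          refine hmu.trans ?_
          gcongr
          refine le_trans ?_ (mul_le_mul_of_nonneg_left hS (by positivity))
          rw [Finset.mul_sum]
          refine Finset.sum_le_sum fun i hi => ?_
          rw [mul_comm]
          have := (hlog i hi).1
          gcongr
          exact (hlog i hi).2
      _ = 2 ^ p * 3 ^ (p / 2) * 2 * (L ^ (p / 2) * (M + 1)) := by
          rw [Real.mul_rpow (by norm_num) (by linarith)]; ring
      _ ≤ 2 ^ p * 2 ^ p * 20 ^ p * (L ^ (p / 2) * (M + 1)) := by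
          gcongr
          · exact three_rpow_half_le hp
          · exact le_trans (by norm_num) (self_le_rpow_self (b := 20) (by norm_num) hp)
      _ = _ := by
          rw [← Real.mul_rpow (by norm_num) (by norm_num),
            ← Real.mul_rpow (by norm_num) (by norm_num)]
          norm_num

/-- There exist universal constants `C ≥ c > 0` such that for all `0 ≤ r < ∞`, `1 ≤ p < ∞`,
`n ≥ 2` and `X` standard Gaussian in `ℝ^n`, every median `m` of `∑_{i=1}^n i^{-r} X_[i]^p`
satisfies: if `r ≤ 1` then
`c^p p^{p/2} n^{1-r} (ln n)^{1+p/2} / [p+(1-r) ln n]^{1+p/2} ≤ m ≤`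
`C^p p^{p/2} n^{1-r} (ln n)^{1+p/2} / [p+(1-r) ln n]^{1+p/2}`, and if `r ≥ 1` then
`c^p (ln n)^{1+p/2}/(1+(r-1) ln n) + c^p (ln n)^{p/2} ≤ m ≤`
`C^p (ln n)^{1+p/2}/(1+(r-1) ln n) + C^p (ln n)^{p/2}`. -/
theorem lorentz_median_bounds :
    ∃ C c : ℝ, 0 < c ∧ c ≤ C ∧
      ∀ (r p : ℝ) (n : ℕ), 0 ≤ r → 1 ≤ p → 2 ≤ n →
        ∀ m : ℝ,
          IsMedian (stdGaussian n)
            (fun x => ∑ i : Fin n, ((i : ℝ) + 1) ^ (-r) * decRe x i ^ p) m →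
          (r ≤ 1 →
            c ^ p * p ^ (p / 2) * (n : ℝ) ^ (1 - r) * Real.log n ^ (1 + p / 2) /
                (p + (1 - r) * Real.log n) ^ (1 + p / 2) ≤ m ∧
            m ≤ C ^ p * p ^ (p / 2) * (n : ℝ) ^ (1 - r) * Real.log n ^ (1 + p / 2) /
                (p + (1 - r) * Real.log n) ^ (1 + p / 2)) ∧
          (1 ≤ r →
            c ^ p * Real.log n ^ (1 + p / 2) / (1 + (r - 1) * Real.log n) +
                c ^ p * Real.log n ^ (p / 2) ≤ m ∧
            m ≤ C ^ p * Real.log n ^ (1 + p / 2) / (1 + (r - 1) * Real.log n) +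
                C ^ p * Real.log n ^ (p / 2)) := by
 
  refine ⟨80, 1 / 5120, by norm_num, by norm_num,
    fun r p n hr hp hn m h => ⟨fun hr1 => ?_, fun hr1 => ?_⟩⟩
  · have hL := half_le_log_natCast hn
    have hL0 : 0 < Real.log n := by linarith
    have hp0 : 0 < p := by linarith
    have ha : 0 ≤ 1 - r := by linarith
    have key (b : ℝ) : b ^ p * p ^ (p / 2) * (n : ℝ) ^ (1 - r) * Real.log n ^ (1 + p / 2) /
        (p + (1 - r) * Real.log n) ^ (1 + p / 2) =
        b ^ p * ((n : ℝ) ^ (1 - r) *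
          (p * Real.log n / (p + (1 - r) * Real.log n)) ^ (1 + p / 2) / p) := by
      rw [Real.div_rpow (by positivity) (by positivity), Real.mul_rpow hp0.le hL0.le,
        Real.rpow_add hp0, Real.rpow_one]
      field_simp
    rw [key, key]
    exact IsMedian.bounds_of_le_one ha (by linarith) hp hn (by simpa using h)
  · have hL := half_le_log_natCast hn
    have hL0 : 0 < Real.log n := by linarith
    have key (b : ℝ) : b ^ p * Real.log n ^ (1 + p / 2) / (1 + (r - 1) * Real.log n) +
        b ^ p * Real.log n ^ (p / 2) =
        b ^ p * (Real.log n ^ (p / 2) * (Real.log n / (1 + (r - 1) * Real.log n) + 1)) := by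
      rw [Real.rpow_add hL0, Real.rpow_one]
      ring
    rw [key, key]
    exact IsMedian.bounds_of_one_le (sub_nonneg.2 hr1) hp hn (by simpa using h)
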